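/- The subgroup G' of H generated by the five elements gr'(ρ₁) = (−1/2;1,0,0,0), gr'(ρ₂) = (−1/2;0,1,0,0), gr'(ρ₃) = (−1/2;0,0,1,0), gr'(ρ₄) = (−1/2;0,0,0,1), and λ = (1;0,0,0,0) has index 2 in H. -/

import Mathlib

/-- The big grading group `G'` of the torus: tuples `(m; a, b, c, d)` with
`m ∈ ½ℤ` a half-integer and `a, b, c, d ∈ ℤ`. -/
def BigGr : Type := {x : ℚ × ℤ × ℤ × ℤ × ℤ // ∃ n : ℤ, x.1 = (n : ℚ) / 2}

namespace BigGr

/-- The Maslov component. -/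
def m (x : BigGr) : ℚ := x.1.1

/-- The first spin-c component. -/
def a (x : BigGr) : ℤ := x.1.2.1

/-- The second spin-c component. -/
def b (x : BigGr) : ℤ := x.1.2.2.1

/-- The third spin-c component. -/
def c (x : BigGr) : ℤ := x.1.2.2.2.1

/-- The fourth spin-c component. -/
def d (x : BigGr) : ℤ := x.1.2.2.2.2

/-- Construct an element `(m; a, b, c, d)` of the big grading group. -/
def mk (m₀ : ℚ) (a₀ b₀ c₀ d₀ : ℤ) (h : ∃ n : ℤ, m₀ = (n : ℚ) / 2) : BigGr :=
  ⟨(m₀, a₀, b₀, c₀, d₀), h⟩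

/-- The multiplication
`(m;a,b,c,d)·(m';a',b',c',d') = (m+m'+½|a b;a' b'|+½|b c;b' c'|+½|c d;c' d'|+½|d a;d' a'|;
a+a', b+b', c+c', d+d')`. -/
def bmul (x y : BigGr) : BigGr :=
  ⟨(x.m + y.m + ((x.a * y.b - y.a * x.b : ℤ) : ℚ) / 2 + ((x.b * y.c - y.b * x.c : ℤ) : ℚ) / 2
      + ((x.c * y.d - y.c * x.d : ℤ) : ℚ) / 2 + ((x.d * y.a - y.d * x.a : ℤ) : ℚ) / 2,
    x.a + y.a, x.b + y.b, x.c + y.c, x.d + y.d), by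
      obtain ⟨n, hn⟩ := x.2
      obtain ⟨n', hn'⟩ := y.2
      have hm : x.m = (n : ℚ) / 2 := hn
      have hm' : y.m = (n' : ℚ) / 2 := hn'
      refine ⟨n + n' + (x.a * y.b - y.a * x.b) + (x.b * y.c - y.b * x.c)
        + (x.c * y.d - y.c * x.d) + (x.d * y.a - y.d * x.a), ?_⟩
      dsimp only
      rw [hm, hm']
      push_cast
      ring⟩

/-- The identity element `(0;0,0,0,0)`. -/
def bone : BigGr := ⟨(0, 0, 0, 0, 0), ⟨0, by norm_num⟩⟩

/-- The inverse `(−m;−a,−b,−c,−d)` of `(m;a,b,c,d)`. -/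
def binv (x : BigGr) : BigGr :=
  ⟨(-x.m, -x.a, -x.b, -x.c, -x.d), by
    obtain ⟨n, hn⟩ := x.2
    have hm : x.m = (n : ℚ) / 2 := hn
    refine ⟨-n, ?_⟩
    dsimp only
    rw [hm]
    push_cast
    ring⟩

theorem bmul_assoc (x y z : BigGr) : bmul (bmul x y) z = bmul x (bmul y z) := by
  obtain ⟨⟨m₁, a₁, b₁, c₁, d₁⟩, h₁⟩ := x
  obtain ⟨⟨m₂, a₂, b₂, c₂, d₂⟩, h₂⟩ := y
  obtain ⟨⟨m₃, a₃, b₃, c₃, d₃⟩, h₃⟩ := z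
  apply Subtype.ext
  simp only [bmul, m, a, b, c, d, Prod.mk.injEq]
  refine ⟨?_, ?_, ?_, ?_, ?_⟩ <;> push_cast <;> ring

theorem bone_mul (x : BigGr) : bmul bone x = x := by
  obtain ⟨⟨m₁, a₁, b₁, c₁, d₁⟩, h₁⟩ := x
  apply Subtype.ext
  simp only [bmul, bone, m, a, b, c, d, Prod.mk.injEq]
  refine ⟨?_, ?_, ?_, ?_, ?_⟩ <;> push_cast <;> ring

theorem bmul_one (x : BigGr) : bmul x bone = x := by
  obtain ⟨⟨m₁, a₁, b₁, c₁, d₁⟩, h₁⟩ := x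
  apply Subtype.ext
  simp only [bmul, bone, m, a, b, c, d, Prod.mk.injEq]
  refine ⟨?_, ?_, ?_, ?_, ?_⟩ <;> push_cast <;> ring

theorem binv_mul_cancel (x : BigGr) : bmul (binv x) x = bone := by
  obtain ⟨⟨m₁, a₁, b₁, c₁, d₁⟩, h₁⟩ := x
  apply Subtype.ext
  simp only [bmul, bone, binv, m, a, b, c, d, Prod.mk.injEq]
  refine ⟨?_, ?_, ?_, ?_, ?_⟩ <;> push_cast <;> ring

instance instGroup : Group BigGr where
  mul := bmul
  one := bone
  inv := binv
  mul_assoc := bmul_assoc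
  one_mul := bone_mul
  mul_one := bmul_one
  inv_mul_cancel := binv_mul_cancel

theorem mul_def (x y : BigGr) : x * y = bmul x y := rfl

theorem one_def : (1 : BigGr) = bone := rfl

theorem inv_def (x : BigGr) : x⁻¹ = binv x := rfl

/-- The distinguished central element `λ = (1;0,0,0,0)`. -/
def lam : BigGr := mk 1 0 0 0 0 ⟨2, by norm_num⟩

/-- The weight grading element `λ_w = (1;1,1,1,1)`. -/
def lamw : BigGr := mk 1 1 1 1 1 ⟨2, by norm_num⟩

/-- The grading `gr'(U) = (−1;1,1,1,1)` of the variable `U`. -/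
def grU : BigGr := mk (-1) 1 1 1 1 ⟨-2, by norm_num⟩

/-- `gr'(ρ₁) = (−1/2;1,0,0,0)`. -/
def grRho1 : BigGr := mk (-1/2) 1 0 0 0 ⟨-1, by norm_num⟩

/-- `gr'(ρ₂) = (−1/2;0,1,0,0)`. -/
def grRho2 : BigGr := mk (-1/2) 0 1 0 0 ⟨-1, by norm_num⟩

/-- `gr'(ρ₃) = (−1/2;0,0,1,0)`. -/
def grRho3 : BigGr := mk (-1/2) 0 0 1 0 ⟨-1, by norm_num⟩

/-- `gr'(ρ₄) = (−1/2;0,0,0,1)`. -/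
def grRho4 : BigGr := mk (-1/2) 0 0 0 1 ⟨-1, by norm_num⟩

/-- The anti-automorphism `r'(m;a,b,c,d) = (m;−c,−b,−a,−d)`. -/
def rprime (x : BigGr) : BigGr := ⟨(x.m, -x.c, -x.b, -x.a, -x.d), x.2⟩

end BigGr

namespace BigGr

@[ext]
theorem ext {x y : BigGr} (hm : x.m = y.m) (ha : x.a = y.a) (hb : x.b = y.b) (hc : x.c = y.c)
    (hd : x.d = y.d) : x = y :=
  Subtype.ext (Prod.ext hm (Prod.ext ha (Prod.ext hb (Prod.ext hc hd))))

@[simp] theorem a_mul (x y : BigGr) : (x * y).a = x.a + y.a := rfl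

@[simp] theorem b_mul (x y : BigGr) : (x * y).b = x.b + y.b := rfl

@[simp] theorem c_mul (x y : BigGr) : (x * y).c = x.c + y.c := rfl

@[simp] theorem d_mul (x y : BigGr) : (x * y).d = x.d + y.d := rfl

@[simp] theorem m_mul (x y : BigGr) : (x * y).m = x.m + y.m
    + ((x.a * y.b - y.a * x.b : ℤ) : ℚ) / 2 + ((x.b * y.c - y.b * x.c : ℤ) : ℚ) / 2
    + ((x.c * y.d - y.c * x.d : ℤ) : ℚ) / 2 + ((x.d * y.a - y.d * x.a : ℤ) : ℚ) / 2 := rfl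

section mk

variable (m₀ : ℚ) (a₀ b₀ c₀ d₀ : ℤ) (h : ∃ n : ℤ, m₀ = (n : ℚ) / 2)

@[simp] theorem m_mk : (mk m₀ a₀ b₀ c₀ d₀ h).m = m₀ := rfl

@[simp] theorem a_mk : (mk m₀ a₀ b₀ c₀ d₀ h).a = a₀ := rfl

@[simp] theorem b_mk : (mk m₀ a₀ b₀ c₀ d₀ h).b = b₀ := rfl

@[simp] theorem c_mk : (mk m₀ a₀ b₀ c₀ d₀ h).c = c₀ := rfl

@[simp] theorem d_mk : (mk m₀ a₀ b₀ c₀ d₀ h).d = d₀ := rfl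

end mk

/-- The element obtained from `x` by multiplying every component by `k`. -/
def scale (x : BigGr) (k : ℤ) : BigGr :=
  mk (k * x.m) (k * x.a) (k * x.b) (k * x.c) (k * x.d) <| by
    obtain ⟨n, hn⟩ := x.2
    have hm : x.m = (n : ℚ) / 2 := hn
    exact ⟨k * n, by rw [hm]; push_cast; ring⟩

/-- The one-parameter subgroup through `x`. -/
def scaleHom (x : BigGr) : Multiplicative ℤ →* BigGr :=
  MonoidHom.mk' (fun k => scale x k.toAdd) fun k l => by
    ext <;> simp [scale] <;> ring

theorem zpow_eq_scale (x : BigGr) (k : ℤ) : x ^ k = scale x k := by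
  have h1 : scaleHom x (Multiplicative.ofAdd 1) = x := by
    ext <;> simp [scaleHom, scale]
  have hk := map_zpow (scaleHom x) (Multiplicative.ofAdd 1) k
  rw [h1, ← ofAdd_zsmul, smul_eq_mul, mul_one] at hk
  exact hk.symm

/-- Twice the Maslov component, as an integer. -/
def twiceM (x : BigGr) : ℤ := (2 * x.m).num

theorem m_eq_twiceM_div_two (x : BigGr) : x.m = (x.twiceM : ℚ) / 2 := by
  obtain ⟨n, hn⟩ := x.2
  have hm : x.m = (n : ℚ) / 2 := hn
  have h2 : 2 * x.m = (n : ℚ) := by rw [hm]; ring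
  rw [twiceM, h2, Rat.num_intCast, hm]

theorem twiceM_eq {x : BigGr} {n : ℤ} (h : x.m = (n : ℚ) / 2) : x.twiceM = n := by
  have h' := x.m_eq_twiceM_div_two
  rw [h] at h'
  have : (n : ℚ) = x.twiceM := by linarith
  exact_mod_cast this.symm

theorem twiceM_mul (x y : BigGr) : (x * y).twiceM = x.twiceM + y.twiceM
    + (x.a * y.b - y.a * x.b) + (x.b * y.c - y.b * x.c)
    + (x.c * y.d - y.c * x.d) + (x.d * y.a - y.d * x.a) := by
  apply twiceM_eq
  rw [m_mul, x.m_eq_twiceM_div_two, y.m_eq_twiceM_div_two]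
  push_cast
  ring

/-- The parity homomorphism
`(m;a,b,c,d) ↦ 2m + a + b + c + d + (a + c)(b + d) mod 2`. -/
def parity : BigGr →* Multiplicative (ZMod 2) :=
  MonoidHom.mk' (fun x => Multiplicative.ofAdd
    ((x.twiceM + x.a + x.b + x.c + x.d + (x.a + x.c) * (x.b + x.d) : ℤ) : ZMod 2)) fun x y => by
    rw [← ofAdd_add, ← Int.cast_add, twiceM_mul]
    congr 1
    refine (ZMod.intCast_eq_intCast_iff_dvd_sub _ _ 2).2
      ⟨-(x.a * y.b + x.c * y.d + x.b * y.c + x.d * y.a), ?_⟩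
    simp only [a_mul, b_mul, c_mul, d_mul]
    push_cast
    ring

theorem mem_ker_parity {x : BigGr} : x ∈ parity.ker ↔
    (2 : ℤ) ∣ x.twiceM + x.a + x.b + x.c + x.d + (x.a + x.c) * (x.b + x.d) :=
  ofAdd_eq_one.trans (ZMod.intCast_zmod_eq_zero_iff_dvd _ 2)

theorem closure_eq_ker_parity :
    Subgroup.closure {grRho1, grRho2, grRho3, grRho4, lam} = parity.ker := by
  apply le_antisymm
  · rw [Subgroup.closure_le]
    have key {m₀ a₀ b₀ c₀ d₀ h} (n : ℤ) (hn : m₀ = (n : ℚ) / 2)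
        (hp : (2 : ℤ) ∣ n + a₀ + b₀ + c₀ + d₀ + (a₀ + c₀) * (b₀ + d₀)) :
        mk m₀ a₀ b₀ c₀ d₀ h ∈ parity.ker := by
      rw [mem_ker_parity, twiceM_eq ((m_mk ..).trans hn)]
      exact hp
    rintro x (rfl | rfl | rfl | rfl | rfl)
    iterate 4 exact key (-1) (by norm_num) (by norm_num)
    exact key 2 (by norm_num) (by norm_num)
  · intro x hx
    rw [mem_ker_parity] at hx
    set G := Subgroup.closure {grRho1, grRho2, grRho3, grRho4, lam}
    have h1 : grRho1 ∈ G := Subgroup.subset_closure (by simp)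
    have h2 : grRho2 ∈ G := Subgroup.subset_closure (by simp)
    have h3 : grRho3 ∈ G := Subgroup.subset_closure (by simp)
    have h4 : grRho4 ∈ G := Subgroup.subset_closure (by simp)
    have h5 : lam ∈ G := Subgroup.subset_closure (by simp)
    obtain ⟨k, hk⟩ : (2 : ℤ) ∣ x.twiceM + x.a + x.b + x.c + x.d
        - (x.a * x.b + x.b * x.c + x.c * x.d - x.d * x.a) := by
      obtain ⟨l, hl⟩ := hx
      exact ⟨l - (x.a * x.b + x.b * x.c + x.c * x.d), by linear_combination hl⟩
    have hx' : x = grRho1 ^ x.a * grRho2 ^ x.b * grRho3 ^ x.c * grRho4 ^ x.d * lam ^ k := by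
      have hkq : (x.twiceM + x.a + x.b + x.c + x.d
        - (x.a * x.b + x.b * x.c + x.c * x.d - x.d * x.a) : ℚ) = 2 * k := by exact_mod_cast hk
      simp only [zpow_eq_scale]
      ext <;> simp [scale, grRho1, grRho2, grRho3, grRho4, lam]
      rw [x.m_eq_twiceM_div_two]
      linarith
    rw [hx']
    exact G.mul_mem (G.mul_mem (G.mul_mem (G.mul_mem (G.zpow_mem h1 _) (G.zpow_mem h2 _))
      (G.zpow_mem h3 _)) (G.zpow_mem h4 _)) (G.zpow_mem h5 _)

theorem parity_surjective : Function.Surjective parity := by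
  have h0 : ∃ x, parity x ≠ 1 := by
    refine ⟨mk (1 / 2) 0 0 0 0 ⟨1, by norm_num⟩, fun h => ?_⟩
    rw [← MonoidHom.mem_ker, mem_ker_parity, twiceM_eq (n := 1) (by simp)] at h
    revert h
    norm_num
  obtain ⟨x, hx⟩ := h0
  have key : ∀ u v : Multiplicative (ZMod 2), u ≠ 1 → v = 1 ∨ v = u := by decide
  intro v
  rcases key _ v hx with rfl | rfl
  exacts [⟨1, map_one _⟩, ⟨x, rfl⟩]

end BigGr

/-- the subgroup `G'` of the big grading group generated by `gr'(ρ₁)`,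
`gr'(ρ₂)`, `gr'(ρ₃)`, `gr'(ρ₄)`, and `λ` has index 2. -/
theorem statement5 :
    (Subgroup.closure
      {BigGr.grRho1, BigGr.grRho2, BigGr.grRho3, BigGr.grRho4, BigGr.lam}).index = 2 := by
  rw [BigGr.closure_eq_ker_parity, Subgroup.index_ker,
    MonoidHom.range_eq_top.2 BigGr.parity_surjective, Subgroup.card_top]
  simp
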